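/- arXiv:2411.15401 — 3 statements merged into one kernel-verified Lean document; each statement's English description precedes it below -/
import Mathlib

section
/- Let a < b be real numbers and m, n integers with 0 ≤ m ≤ n−1 and n − m ≤ 3. For all X, Y ∈ 𝒳_{[a,b]}, if X dominates Y in nth degree m-mean preserving stochastic dominance on ℝ ((n,m)SD_ℝ), then X dominates Y in nth degree m-mean preserving stochastic dominance on [a,b] ((n,m)SD_{[a,b]}). -/
open MeasureTheory Filter Set

/-- `E[(η−x)₊^{n−1}]`-integrand: for `n = 1` the indicator of `x ≤ η`,
for `n ≥ 2` the positive part `(η−x)₊` raised to `n−1`. -/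
noncomputable def momFn (n : ℕ) (η x : ℝ) : ℝ :=
  if n = 1 then (if x ≤ η then (1 : ℝ) else 0) else (max (η - x) 0) ^ (n - 1)

/-- `n`th-order stochastic dominance on ℝ: `X ≥ₙ Y`. -/
def SD {Ω : Type*} [MeasurableSpace Ω] (μ : Measure Ω) (X Y : Ω → ℝ) (n : ℕ) : Prop :=
  ∀ η : ℝ, (∫ ω, momFn n η (X ω) ∂μ) ≤ ∫ ω, momFn n η (Y ω) ∂μ

/-- `n`th-order stochastic dominance on `[a, r]`: `X ≥ₙ^{[a,r]} Y`. -/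
def SDI {Ω : Type*} [MeasurableSpace Ω] (μ : Measure Ω) (X Y : Ω → ℝ)
    (n : ℕ) (a r : ℝ) : Prop :=
  (∀ η ∈ Set.Icc a r, (∫ ω, momFn n η (X ω) ∂μ) ≤ ∫ ω, momFn n η (Y ω) ∂μ) ∧
  ∀ k ∈ Finset.Icc 1 n, (∫ ω, (r - X ω) ^ (k - 1) ∂μ) ≤ ∫ ω, (r - Y ω) ^ (k - 1) ∂μ

/-- `(n,m)`-mean-preserving stochastic dominance on `[a,b]`. -/
def MPSDI {Ω : Type*} [MeasurableSpace Ω] (μ : Measure Ω) (X Y : Ω → ℝ)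
    (n m : ℕ) (a b : ℝ) : Prop :=
  SDI μ X Y n a b ∧
  ∀ k ∈ Finset.Icc 1 (m + 1), (∫ ω, (b - X ω) ^ (k - 1) ∂μ) = ∫ ω, (b - Y ω) ^ (k - 1) ∂μ

/-- `(n,m)`-mean-preserving stochastic dominance on ℝ. -/
def MPSDR {Ω : Type*} [MeasurableSpace Ω] (μ : Measure Ω) (X Y : Ω → ℝ)
    (n m : ℕ) : Prop :=
  SD μ X Y n ∧ ∀ k ∈ Finset.Icc 1 m, (∫ ω, (X ω) ^ k ∂μ) = ∫ ω, (Y ω) ^ k ∂μ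

/-- A measurable function with values in a compact interval has integrable powers. -/
lemma integrable_pow_of_mem_Icc {Ω : Type*} [MeasurableSpace Ω] {μ : Measure Ω}
    [IsFiniteMeasure μ] {Z : Ω → ℝ} {c d : ℝ} (hZ : Measurable Z)
    (hZcd : ∀ ω, Z ω ∈ Set.Icc c d) (j : ℕ) : Integrable (fun ω => Z ω ^ j) μ := by
  refine Integrable.of_bound (hZ.pow_const j).aestronglyMeasurable (max |c| |d| ^ j)
    (ae_of_all _ fun ω => ?_)
  rw [norm_pow, Real.norm_eq_abs]
  exact pow_le_pow_left₀ (abs_nonneg _) (abs_le_max_abs_abs (hZcd ω).1 (hZcd ω).2) j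

/-- Binomial expansion of the moments of a translate of a bounded random variable. -/
lemma integral_add_const_pow {Ω : Type*} [MeasurableSpace Ω] {μ : Measure Ω}
    [IsFiniteMeasure μ] {Z : Ω → ℝ} {c d : ℝ} (hZ : Measurable Z)
    (hZcd : ∀ ω, Z ω ∈ Set.Icc c d) (t : ℝ) (N : ℕ) :
    ∫ ω, (Z ω + t) ^ N ∂μ =
      ∑ j ∈ Finset.range (N + 1), (∫ ω, Z ω ^ j ∂μ) * t ^ (N - j) * (N.choose j : ℝ) := by
  simp_rw [add_pow]
  rw [integral_finsetSum _ fun j _ =>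
    ((integrable_pow_of_mem_Icc hZ hZcd j).mul_const _).mul_const _]
  simp_rw [integral_mul_const]

/-- Equality of the raw moments up to order `m` gives equality of the moments of `b - X` and
`b - Y` up to order `m`. -/
lemma integral_const_sub_pow_eq {Ω : Type*} [MeasurableSpace Ω] {μ : Measure Ω}
    [IsFiniteMeasure μ] {X Y : Ω → ℝ} {a b : ℝ} {m : ℕ} (hX : Measurable X) (hY : Measurable Y)
    (hXab : ∀ ω, X ω ∈ Set.Icc a b) (hYab : ∀ ω, Y ω ∈ Set.Icc a b)
    (h : ∀ k ∈ Finset.Icc 1 m, (∫ ω, X ω ^ k ∂μ) = ∫ ω, Y ω ^ k ∂μ) {j : ℕ} (hj : j ≤ m) :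
    ∫ ω, (b - X ω) ^ j ∂μ = ∫ ω, (b - Y ω) ^ j ∂μ := by
  have flip (Z : Ω → ℝ) :
      ∫ ω, (b - Z ω) ^ j ∂μ = (-1) ^ j * ∫ ω, (Z ω + -b) ^ j ∂μ := by
    rw [← integral_const_mul]
    congr 1 with ω
    rw [← mul_pow]
    ring
  rw [flip X, flip Y, integral_add_const_pow hX hXab, integral_add_const_pow hY hYab]
  congr 1
  refine Finset.sum_congr rfl fun i hi => ?_
  rcases Nat.eq_zero_or_pos i with rfl | hi0
  · simp
  · rw [h i (Finset.mem_Icc.2 ⟨hi0, by have := Finset.mem_range.1 hi; lia⟩)]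

/-- Above the range of the variables, stochastic dominance compares full moments. -/
lemma SD.integral_const_sub_pow_le {Ω : Type*} [MeasurableSpace Ω] {μ : Measure Ω}
    {X Y : Ω → ℝ} {n : ℕ} {η : ℝ} (h : SD μ X Y n)
    (hX : ∀ ω, X ω ≤ η) (hY : ∀ ω, Y ω ≤ η) :
    ∫ ω, (η - X ω) ^ (n - 1) ∂μ ≤ ∫ ω, (η - Y ω) ^ (n - 1) ∂μ := by
  have momFn_eq {x : ℝ} (hx : x ≤ η) : momFn n η x = (η - x) ^ (n - 1) := by
    unfold momFn
    split_ifs with hn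
    · simp [hn]
    · rw [max_eq_left (sub_nonneg.2 hx)]
  simpa only [momFn_eq (hX _), momFn_eq (hY _)] using h η

/-- An affine function which is nonnegative on the nonnegative half-line has nonnegative slope. -/
lemma slope_nonneg_of_forall_nonneg {p q : ℝ} (h : ∀ t : ℝ, 0 ≤ t → 0 ≤ p * t + q) : 0 ≤ p := by
  by_contra! hp
  have key := h ((|q| + 1) / -p) (div_nonneg (by positivity) (by linarith))
  have hmul : p * ((|q| + 1) / -p) = -(|q| + 1) := by
    have hp0 := hp.ne
    field_simp
  linarith [le_abs_self q]

/-- If `X` dominates `Y` in order `m + 3` and the moments of `b - X`, `b - Y` agree up to order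
`m`, then the moments of order `m + 1` are ordered. -/
lemma SD.integral_const_sub_pow_succ_le {Ω : Type*} [MeasurableSpace Ω] {μ : Measure Ω}
    [IsFiniteMeasure μ] {X Y : Ω → ℝ} {a b : ℝ} {m : ℕ} (hX : Measurable X) (hY : Measurable Y)
    (hXab : ∀ ω, X ω ∈ Set.Icc a b) (hYab : ∀ ω, Y ω ∈ Set.Icc a b) (h : SD μ X Y (m + 3))
    (heq : ∀ j ≤ m, ∫ ω, (b - X ω) ^ j ∂μ = ∫ ω, (b - Y ω) ^ j ∂μ) :
    ∫ ω, (b - X ω) ^ (m + 1) ∂μ ≤ ∫ ω, (b - Y ω) ^ (m + 1) ∂μ := by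
  have expand {Z : Ω → ℝ} (hZ : Measurable Z) (hZab : ∀ ω, Z ω ∈ Set.Icc a b) (t : ℝ) :
      ∫ ω, (b + t - Z ω) ^ (m + 2) ∂μ =
        ∑ j ∈ Finset.range (m + 1),
          (∫ ω, (b - Z ω) ^ j ∂μ) * t ^ (m + 2 - j) * ((m + 2).choose j : ℝ)
        + (∫ ω, (b - Z ω) ^ (m + 1) ∂μ) * t * (m + 2) + ∫ ω, (b - Z ω) ^ (m + 2) ∂μ := by
    have hmem : ∀ ω, b - Z ω ∈ Set.Icc 0 (b - a) := fun ω =>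
      ⟨sub_nonneg.2 (hZab ω).2, sub_le_sub_left (hZab ω).1 b⟩
    have hmom := integral_add_const_pow (μ := μ) (Z := fun ω => b - Z ω)
      (measurable_const.sub hZ) hmem t (m + 2)
    rw [Finset.sum_range_succ, Finset.sum_range_succ] at hmom
    have hchoose : (m + 2).choose (m + 1) = m + 2 := Nat.choose_succ_self_right (m + 1)
    have hsub : m + 2 - (m + 1) = 1 := by lia
    simp only [hchoose, hsub, Nat.choose_self, Nat.sub_self, pow_zero, pow_one, mul_one,
      Nat.cast_one, Nat.cast_add, Nat.cast_ofNat] at hmom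
    rw [← hmom]
    congr 1 with ω
    ring
  have hslope : 0 ≤ (∫ ω, (b - Y ω) ^ (m + 1) ∂μ - ∫ ω, (b - X ω) ^ (m + 1) ∂μ) * (m + 2) := by
    refine slope_nonneg_of_forall_nonneg
      (q := ∫ ω, (b - Y ω) ^ (m + 2) ∂μ - ∫ ω, (b - X ω) ^ (m + 2) ∂μ) fun t ht => ?_
    have hle := h.integral_const_sub_pow_le (η := b + t)
      (fun ω => by linarith [(hXab ω).2]) (fun ω => by linarith [(hYab ω).2])
    rw [show m + 3 - 1 = m + 2 by lia, expand hX hXab, expand hY hYab] at hle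
    have hsum : ∑ j ∈ Finset.range (m + 1),
          (∫ ω, (b - X ω) ^ j ∂μ) * t ^ (m + 2 - j) * ((m + 2).choose j : ℝ) =
        ∑ j ∈ Finset.range (m + 1),
          (∫ ω, (b - Y ω) ^ j ∂μ) * t ^ (m + 2 - j) * ((m + 2).choose j : ℝ) :=
      Finset.sum_congr rfl fun j hj => by rw [heq j (Nat.lt_succ_iff.1 (Finset.mem_range.1 hj))]
    linarith
  exact sub_nonneg.1 (nonneg_of_mul_nonneg_left hslope (by positivity))

theorem stmt_16 {Ω : Type*} [MeasurableSpace Ω] (μ : Measure Ω) [IsProbabilityMeasure μ]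
    (a b : ℝ) (hab : a < b) (m n : ℕ) (hmn : m + 1 ≤ n) (hnm : n ≤ m + 3)
    (X Y : Ω → ℝ) (hX : Measurable X) (hY : Measurable Y)
    (hXab : ∀ ω, X ω ∈ Set.Icc a b) (hYab : ∀ ω, Y ω ∈ Set.Icc a b)
    (h : MPSDR μ X Y n m) : MPSDI μ X Y n m a b := by
  obtain ⟨hSD, hmom⟩ := h
  have heq : ∀ j ≤ m, ∫ ω, (b - X ω) ^ j ∂μ = ∫ ω, (b - Y ω) ^ j ∂μ := fun j hj =>
    integral_const_sub_pow_eq hX hY hXab hYab hmom hj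
  refine ⟨⟨fun η _ => hSD η, fun k hk => ?_⟩, fun k hk => heq _ ?_⟩
  · obtain ⟨hk1, hkn⟩ := Finset.mem_Icc.1 hk
    rcases le_or_gt (k - 1) m with hkm | hkm
    · exact (heq _ hkm).le
    · rcases hkn.eq_or_lt with rfl | hlt
      · exact hSD.integral_const_sub_pow_le (fun ω => (hXab ω).2) (fun ω => (hYab ω).2)
      · obtain rfl : n = m + 3 := by lia
        rw [show k - 1 = m + 1 by lia]
        exact hSD.integral_const_sub_pow_succ_le hX hY hXab hYab heq
  · have := Finset.mem_Icc.1 hk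
    lia
end

section
/- Let a < b be real numbers and m, n integers with 0 ≤ m ≤ n−1 and n − m ≥ 4. There exist random variables X, Y taking values in [a,b] such that X dominates Y in nth degree m-mean preserving stochastic dominance on ℝ ((n,m)SD_ℝ) but X does not dominate Y in nth degree m-mean preserving stochastic dominance on [a,b] ((n,m)SD_{[a,b]}). -/
open MeasureTheory Filter Set

/-- A finitely supported signed measure of total mass zero is, up to a positive factor, the
difference of the laws of two random variables with values in its support. -/
lemma exists_integral_sub_eq_sum {ι : Type} [Fintype ι] (w x : ι → ℝ)
    (hsum : ∑ i, w i = 0) (i₀ : ι) (hne : w i₀ ≠ 0) :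
    ∃ (Ω : Type) (_ : MeasurableSpace Ω) (μ : Measure Ω) (_ : IsProbabilityMeasure μ)
      (X Y : Ω → ℝ) (c : ℝ), Measurable X ∧ Measurable Y ∧
      (∀ ω, X ω ∈ range x) ∧ (∀ ω, Y ω ∈ range x) ∧ 0 < c ∧
      ∀ g : ℝ → ℝ, ∫ ω, g (Y ω) ∂μ - ∫ ω, g (X ω) ∂μ = c * ∑ i, w i * g (x i) := by
  classical
  let W : ℝ := ∑ i, |w i|
  have hW : 0 < W := Finset.sum_pos' (fun i _ => abs_nonneg _)
    ⟨i₀, Finset.mem_univ _, abs_pos.mpr hne⟩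
  have hmass : ∑ i, ENNReal.ofReal (|w i| / W) = 1 := by
    rw [← ENNReal.ofReal_sum_of_nonneg (fun i _ => by positivity), ← Finset.sum_div,
      div_self hW.ne', ENNReal.ofReal_one]
  let p : PMF ι := PMF.ofFintype (fun i => ENNReal.ofReal (|w i| / W)) hmass
  let _ : MeasurableSpace ι := ⊤
  refine ⟨ι, ⊤, p.toMeasure, inferInstance,
    fun i => if w i < 0 then x i else x i₀, fun i => if 0 < w i then x i else x i₀, W⁻¹,
    measurable_from_top, measurable_from_top, fun i => ?_, fun i => ?_, inv_pos.mpr hW,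
    fun g => ?_⟩
  · dsimp only; split_ifs <;> exact mem_range_self _
  · dsimp only; split_ifs <;> exact mem_range_self _
  · have hp : ∀ i, (p i).toReal = |w i| / W := fun i => by
      simp only [p, PMF.ofFintype_apply]
      exact ENNReal.toReal_ofReal (by positivity)
    rw [PMF.integral_eq_sum, PMF.integral_eq_sum, ← Finset.sum_sub_distrib]
    have hterm : ∀ i, (p i).toReal • g (if 0 < w i then x i else x i₀) -
        (p i).toReal • g (if w i < 0 then x i else x i₀) =
        W⁻¹ * (w i * g (x i)) - W⁻¹ * g (x i₀) * w i := fun i => by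
      rw [hp, smul_eq_mul, smul_eq_mul]
      rcases lt_trichotomy (w i) 0 with h | h | h
      · rw [if_neg h.not_gt, if_pos h, abs_of_neg h]; ring
      · simp [h]
      · rw [if_pos h, if_neg h.not_gt, abs_of_pos h]; ring
    rw [Finset.sum_congr rfl fun i _ => hterm i, Finset.sum_sub_distrib, ← Finset.mul_sum,
      ← Finset.mul_sum, hsum, mul_zero, sub_zero]

lemma fwdDiff_iter_succ_id_mul (h : ℝ) (q : ℕ) (f : ℝ → ℝ) (x : ℝ) :
    (fwdDiff h)^[q + 1] (fun y => y * f y) x =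
      x * (fwdDiff h)^[q + 1] f x + (q + 1) * h * (fwdDiff h)^[q] f (x + h) := by
  induction q generalizing x with
  | zero =>
    simp only [zero_add, Function.iterate_one, fwdDiff, Function.iterate_zero_apply]
    push_cast
    ring
  | succ q ih =>
    have hs : ∀ (r : ℕ) (k : ℝ → ℝ) (y : ℝ),
        (fwdDiff h)^[r + 1] k y = (fwdDiff h)^[r] k (y + h) - (fwdDiff h)^[r] k y := fun r k y => by
      rw [Function.iterate_succ_apply', fwdDiff]
    rw [hs (q + 1), ih, ih, hs (q + 1) f x, hs q f (x + h)]
    push_cast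
    ring

lemma fwdDiff_iter_pow_eq_zero (h : ℝ) {k q : ℕ} (hk : k < q) (x : ℝ) :
    (fwdDiff h)^[q] (fun y : ℝ => y ^ k) x = 0 := by
  induction k generalizing q x with
  | zero =>
    obtain ⟨q, rfl⟩ := Nat.exists_eq_add_of_lt hk
    simp only [pow_zero, zero_add]
    rw [Function.iterate_succ_apply, fwdDiff_const]
    exact congrFun (Function.iterate_fixed (fwdDiff_const h (0 : ℝ)) q) x
  | succ k ih =>
    obtain ⟨r, rfl⟩ : ∃ r, q = r + 1 := ⟨q - 1, by omega⟩
    simp only [pow_succ']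
    rw [fwdDiff_iter_succ_id_mul, ih (by omega), ih (by omega)]
    ring

lemma fwdDiff_iter_pow_self (h : ℝ) (q : ℕ) (x : ℝ) :
    (fwdDiff h)^[q] (fun y : ℝ => y ^ q) x = q.factorial * h ^ q := by
  induction q generalizing x with
  | zero => simp
  | succ q ih =>
    simp only [pow_succ' _ q]
    rw [fwdDiff_iter_succ_id_mul, ih, fwdDiff_iter_pow_eq_zero h (Nat.lt_succ_self q),
      Nat.factorial_succ]
    push_cast
    ring

lemma fwdDiff_iter_pow_succ (h : ℝ) (q : ℕ) (x : ℝ) :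
    (fwdDiff h)^[q] (fun y : ℝ => y ^ (q + 1)) x =
      (q + 1).factorial * h ^ q * (x + q * h / 2) := by
  induction q generalizing x with
  | zero => simp
  | succ q ih =>
    simp only [pow_succ' _ (q + 1)]
    rw [fwdDiff_iter_succ_id_mul, ih, fwdDiff_iter_pow_self, Nat.factorial_succ (q + 1)]
    push_cast
    ring

lemma hasDerivAt_max_zero_pow (N : ℕ) (x : ℝ) :
    HasDerivAt (fun y : ℝ => max y 0 ^ (N + 2)) ((N + 2) * max x 0 ^ (N + 1)) x := by
  rcases lt_trichotomy x 0 with hx | rfl | hx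
  · rw [max_eq_right hx.le, zero_pow (Nat.succ_ne_zero N), mul_zero]
    refine (hasDerivAt_const x (0 : ℝ)).congr_of_eventuallyEq ?_
    filter_upwards [eventually_lt_nhds hx] with y hy
    simp [max_eq_right hy.le]
  · have hO : (fun y : ℝ => max y 0 ^ (N + 2)) =O[nhds 0] fun y => ‖y - 0‖ ^ (N + 2) := by
      refine Asymptotics.isBigO_of_le _ fun y => ?_
      rw [norm_pow, norm_pow, norm_norm, sub_zero]
      gcongr
      rcases le_total y 0 with h | h <;> simp [h]
    simpa using (hO.hasFDerivAt (by omega)).hasDerivAt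
  · rw [max_eq_left hx.le]
    have := hasDerivAt_pow (N + 2) x
    push_cast at this
    refine this.congr_of_eventuallyEq ?_
    filter_upwards [eventually_gt_nhds hx] with y hy
    simp [max_eq_left hy.le]

/-- The truncated-power spline with knots `0, L, 2L` and weights `1, -3, 3`. -/
noncomputable def truncSpline (L : ℝ) (N : ℕ) (u : ℝ) : ℝ :=
  max u 0 ^ N - 3 * max (u - L) 0 ^ N + 3 * max (u - 2 * L) 0 ^ N

lemma truncSpline_two_nonneg {L : ℝ} (hL : 0 ≤ L) (u : ℝ) : 0 ≤ truncSpline L 2 u := by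
  unfold truncSpline
  rcases le_total u 0 with h0 | h0
  · rw [max_eq_right h0, max_eq_right (by linarith), max_eq_right (by linarith)]; norm_num
  rcases le_total u L with h1 | h1
  · rw [max_eq_left h0, max_eq_right (by linarith), max_eq_right (by linarith)]
    nlinarith [sq_nonneg u]
  rcases le_total u (2 * L) with h2 | h2
  · rw [max_eq_left h0, max_eq_left (by linarith), max_eq_right (by linarith)]
    nlinarith [mul_nonneg (sub_nonneg.2 h1) (sub_nonneg.2 h2)]
  · rw [max_eq_left h0, max_eq_left (by linarith), max_eq_left (by linarith)]
    nlinarith [sq_nonneg (u - 3 * L)]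

lemma hasDerivAt_truncSpline (L : ℝ) (N : ℕ) (u : ℝ) :
    HasDerivAt (truncSpline L (N + 2)) ((N + 2) * truncSpline L (N + 1) u) u := by
  have h (c : ℝ) := (hasDerivAt_max_zero_pow N (u - c)).comp_sub_const u c
  have h0 := hasDerivAt_max_zero_pow N u
  refine ((h0.sub ((h L).const_mul 3)).add ((h (2 * L)).const_mul 3)).congr_deriv ?_
  unfold truncSpline
  ring

lemma HasDerivAt.fwdDiff_iter {f f' : ℝ → ℝ} (hf : ∀ x, HasDerivAt f (f' x) x)
    (h : ℝ) (q : ℕ) (x : ℝ) : HasDerivAt ((fwdDiff h)^[q] f) ((fwdDiff h)^[q] f' x) x := by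
  induction q generalizing x with
  | zero => exact hf x
  | succ q ih =>
    rw [Function.iterate_succ_apply', Function.iterate_succ_apply']
    exact ((ih (x + h)).comp_add_const x h).sub (ih x)

lemma fwdDiff_iter_truncSpline_nonneg {h L : ℝ} (hh : 0 ≤ h) (hL : 0 ≤ L) (q : ℕ) (u : ℝ) :
    0 ≤ (fwdDiff h)^[q] (truncSpline L (q + 2)) u := by
  induction q generalizing u with
  | zero => exact truncSpline_two_nonneg hL u
  | succ q ih =>
    rw [Function.iterate_succ_apply', fwdDiff, sub_nonneg]
    refine monotone_of_hasDerivAt_nonneg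
      (HasDerivAt.fwdDiff_iter (hasDerivAt_truncSpline L (q + 1)) h q) (fun v => ?_)
      (le_add_of_nonneg_right hh)
    have := fwdDiff_iter_const_smul h (((q + 1 : ℕ) : ℝ) + 2) (truncSpline L (q + 2)) q
    have hv := congrFun this v
    simp only [Pi.smul_apply, smul_eq_mul] at hv
    change (0 : ℝ) ≤ (fwdDiff h)^[q] ((((q + 1 : ℕ) : ℝ) + 2) • truncSpline L (q + 2)) v
    rw [hv]
    exact mul_nonneg (by positivity) (ih v)

lemma fwdDiff_iter_comp_const_sub (h η : ℝ) (q : ℕ) (f : ℝ → ℝ) (y : ℝ) :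
    (fwdDiff (-h))^[q] (fun x => f (η - x)) y = (fwdDiff h)^[q] f (η - y) := by
  induction q generalizing y with
  | zero => rfl
  | succ q ih =>
    rw [Function.iterate_succ_apply', Function.iterate_succ_apply', fwdDiff, fwdDiff, ih, ih,
      show η - (y + -h) = η - y + h by ring]

lemma fwdDiff_iter_truncSpline (h L : ℝ) (q N : ℕ) (u : ℝ) :
    (fwdDiff h)^[q] (truncSpline L N) u = (fwdDiff h)^[q] (fun v => max v 0 ^ N) u -
      3 * (fwdDiff h)^[q] (fun v => max v 0 ^ N) (u - L) +
      3 * (fwdDiff h)^[q] (fun v => max v 0 ^ N) (u - 2 * L) := by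
  induction q generalizing u with
  | zero => rfl
  | succ q ih =>
    simp only [Function.iterate_succ_apply', fwdDiff, ih, sub_add_eq_add_sub]
    ring

/-- The functional `g ↦ Δ^q g (b - 2L) - 3 Δ^q g (b - L) + 3 Δ^q g b` with differences of step
`-h` is a finite weighted sum of point evaluations in `[b - 2L - qh, b]`. -/
lemma exists_sum_eq_fwdDiff_iter (h L b : ℝ) (hh : 0 ≤ h) (hL : 0 ≤ L) (q : ℕ) :
    ∃ w x : Fin 3 × Fin (q + 1) → ℝ, (∀ i, x i ∈ Icc (b - 2 * L - q * h) b) ∧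
      ∀ g : ℝ → ℝ, ∑ i, w i * g (x i) =
        (fwdDiff (-h))^[q] g (b - 2 * L) - 3 * (fwdDiff (-h))^[q] g (b - L) +
          3 * (fwdDiff (-h))^[q] g b := by
  refine ⟨fun i => ![1, -3, 3] i.1 * ((-1) ^ (q - i.2.val) * q.choose i.2),
    fun i => ![b - 2 * L, b - L, b] i.1 - i.2.val * h, ?_, fun g => ?_⟩
  · rintro ⟨j, i⟩
    have hi : (i.val : ℝ) ≤ q := by exact_mod_cast Nat.lt_succ_iff.mp i.2
    have h1 : (i.val : ℝ) * h ≤ q * h := by gcongr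
    have h2 : 0 ≤ (i.val : ℝ) * h := by positivity
    fin_cases j <;> constructor <;> simp <;> linarith
  · have hΔ : ∀ y, (fwdDiff (-h))^[q] g y =
        ∑ i : Fin (q + 1), (-1) ^ (q - i.val) * q.choose i * g (y - i.val * h) := fun y => by
      rw [fwdDiff_iter_eq_sum_shift, Finset.sum_range]
      refine Finset.sum_congr rfl fun i _ => ?_
      simp [sub_eq_add_neg]
    simp only [Fintype.sum_prod_type, Fin.sum_univ_three, hΔ, Finset.mul_sum,
      Matrix.cons_val_zero, Matrix.cons_val_one, Matrix.cons_val]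
    simp only [one_mul, neg_mul, mul_assoc, Finset.sum_neg_distrib, sub_eq_add_neg]

theorem stmt_17 (a b : ℝ) (hab : a < b) (m n : ℕ) (hmn : m + 1 ≤ n) (hnm : m + 4 ≤ n) :
    ∃ (Ω : Type) (_ : MeasurableSpace Ω) (μ : Measure Ω) (_ : IsProbabilityMeasure μ)
      (X Y : Ω → ℝ), Measurable X ∧ Measurable Y ∧
      (∀ ω, X ω ∈ Set.Icc a b) ∧ (∀ ω, Y ω ∈ Set.Icc a b) ∧
      MPSDR μ X Y n m ∧ ¬ MPSDI μ X Y n m a b := by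
  obtain ⟨q, rfl⟩ : ∃ q, n = q + 3 := ⟨n - 3, by omega⟩
  have hq : (0 : ℝ) < q := by exact_mod_cast (by omega : 0 < q)
  obtain ⟨h, hh, hqh⟩ : ∃ h : ℝ, 0 < h ∧ 3 * (q * h) = b - a :=
    ⟨(b - a) / (3 * q), div_pos (sub_pos.2 hab) (by positivity), by field_simp⟩
  have hL : 0 < q * h := mul_pos hq hh
  obtain ⟨w, x, hx, hΛ⟩ := exists_sum_eq_fwdDiff_iter h (q * h) b hh.le hL.le q
  have hpow : ∀ k < q, ∑ i, w i * x i ^ k = 0 := fun k hk => by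
    rw [hΛ fun y => y ^ k]
    simp [fwdDiff_iter_pow_eq_zero _ hk]
  have hneg : ∑ i, w i * (b - x i) ^ (q + 1) < 0 := by
    have hval : ∑ i, w i * (b - x i) ^ (q + 1) =
        -((q + 1).factorial * h ^ q * (q * h / 2)) := by
      rw [hΛ fun y => (b - y) ^ (q + 1)]
      simp only [fwdDiff_iter_comp_const_sub h b q (fun y => y ^ (q + 1)),
        fwdDiff_iter_pow_succ]
      ring
    rw [hval, neg_lt_zero]
    positivity
  have hpos : ∀ η, 0 ≤ ∑ i, w i * max (η - x i) 0 ^ (q + 2) := fun η => by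
    rw [hΛ fun y => max (η - y) 0 ^ (q + 2)]
    simp only [fwdDiff_iter_comp_const_sub h η q (fun y => max y 0 ^ (q + 2))]
    have := fwdDiff_iter_truncSpline_nonneg hh.le hL.le q (η - (b - 2 * (q * h)))
    rw [fwdDiff_iter_truncSpline] at this
    convert this using 4 <;> ring_nf
  obtain ⟨i₀, -, hi₀⟩ := Finset.exists_ne_zero_of_sum_ne_zero hneg.ne
  obtain ⟨Ω, _, μ, hμ, X, Y, c, hX, hY, hXr, hYr, hc, hint⟩ :=
    exists_integral_sub_eq_sum w x (by simpa using hpow 0 (by omega)) i₀ (left_ne_zero_of_mul hi₀)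
  have hsub : range x ⊆ Icc a b := by
    rintro _ ⟨i, rfl⟩
    exact ⟨by linarith [(hx i).1], (hx i).2⟩
  refine ⟨Ω, _, μ, hμ, X, Y, hX, hY, fun ω => hsub (hXr ω), fun ω => hsub (hYr ω),
    ⟨fun η => ?_, fun k hk => ?_⟩, fun H => ?_⟩
  · rw [← sub_nonneg, hint fun y => momFn (q + 3) η y]
    simpa [momFn] using mul_nonneg hc.le (hpos η)
  · have := hint fun y => y ^ k
    rw [hpow k (by have := (Finset.mem_Icc.mp hk).2; omega), mul_zero, sub_eq_zero] at this
    exact this.symm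
  · have hle := H.1.2 (q + 2) (Finset.mem_Icc.mpr ⟨by omega, by omega⟩)
    have := hint fun y => (b - y) ^ (q + 1)
    have hlt := mul_neg_of_pos_of_neg hc hneg
    simp only [Nat.add_succ_sub_one] at hle
    linarith
end

section
/- Let a < b < c be real numbers and m, n integers with 0 ≤ m ≤ n−1 and n − m ≥ 4, and define u(x) = −(b−x)^{m+2} for x ∈ ℝ. Then u ∈ 𝒰_{(n,m)-cv}^{[a,b]}, but there is no v ∈ 𝒰_{(n,m)-cv}^{[a,c]} with v(x) = u(x) for all x ∈ [a,b]. -/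
open Set

/-- The class of `i`-concave utilities on `[p,q]`: for `i = 1`, increasing on `[p,q]`;
for `i = 2`, increasing and concave on `[p,q]`; for `i ≥ 3`, `(i-2)`-times differentiable
with `(-1)^(i-2) * u^(i-2)` increasing and concave on `[p,q]`. -/
def UCv (i : ℕ) (p q : ℝ) (u : ℝ → ℝ) : Prop :=
  (∀ k < i - 2, Differentiable ℝ (iteratedDeriv k u)) ∧
  MonotoneOn (fun x => (-1 : ℝ) ^ (i - 2) * iteratedDeriv (i - 2) u x) (Set.Icc p q) ∧
  (2 ≤ i → ConcaveOn ℝ (Set.Icc p q) (fun x => (-1 : ℝ) ^ (i - 2) * iteratedDeriv (i - 2) u x))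

/-- The signed iterated derivatives of `x ↦ -(b - x) ^ N`. -/
lemma neg_one_pow_mul_iteratedDeriv_neg_sub_pow (b : ℝ) (N k : ℕ) (x : ℝ) :
    (-1 : ℝ) ^ k * iteratedDeriv k (fun x : ℝ => -(b - x) ^ N) x
      = -((N.descFactorial k : ℝ) * (b - x) ^ (N - k)) := by
  have formula : iteratedDeriv k (fun x : ℝ => -(b - x) ^ N)
      = fun x => -((-1 : ℝ) ^ k * ((N.descFactorial k : ℝ) * (b - x) ^ (N - k))) := by
    induction k with
    | zero => simp
    | succ k ih =>
      rw [iteratedDeriv_succ, ih]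
      funext y
      have h := ((((hasDerivAt_id y).const_sub b).pow (N - k)).const_mul
        (N.descFactorial k : ℝ)).const_mul ((-1 : ℝ) ^ k)
      refine h.neg.deriv.trans ?_
      rw [Nat.descFactorial_succ, Nat.sub_add_eq]
      push_cast
      simp only [id]
      ring
  have hsq : (-1 : ℝ) ^ k * (-1) ^ k = 1 := by rw [← mul_pow]; simp
  rw [formula]
  linear_combination -((N.descFactorial k : ℝ) * (b - x) ^ (N - k)) * hsq

lemma monotoneOn_neg_mul_sub_pow {a b C : ℝ} (hC : 0 ≤ C) (j : ℕ) :
    MonotoneOn (fun x : ℝ => -(C * (b - x) ^ j)) (Icc a b) := by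
  intro x _ y hy hxy
  have : 0 ≤ b - y := sub_nonneg.2 hy.2
  dsimp only
  gcongr

lemma concaveOn_neg_mul_sub_pow {a b C : ℝ} (hC : 0 ≤ C) (j : ℕ) :
    ConcaveOn ℝ (Icc a b) (fun x : ℝ => -(C * (b - x) ^ j)) := by
  refine ⟨convex_Icc a b, fun x hx y hy s t hs ht hst => ?_⟩
  have h := (convexOn_pow j).2 (mem_Ici.2 (sub_nonneg.2 hx.2))
    (mem_Ici.2 (sub_nonneg.2 hy.2)) hs ht hst
  simp only [smul_eq_mul] at h ⊢
  have e : s * (b - x) + t * (b - y) = b - (s * x + t * y) := by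
    linear_combination b * hst
  rw [e] at h
  nlinarith [mul_le_mul_of_nonneg_left h hC]

lemma uCv_neg_sub_pow (i N : ℕ) (a b : ℝ) : UCv i a b (fun x : ℝ => -(b - x) ^ N) := by
  have hsmooth : ContDiff ℝ ⊤ (fun x : ℝ => -(b - x) ^ N) := by fun_prop
  refine ⟨fun k _ => hsmooth.differentiable_iteratedDeriv k (WithTop.coe_lt_top _), ?_, fun _ => ?_⟩
  · simp only [neg_one_pow_mul_iteratedDeriv_neg_sub_pow]
    exact monotoneOn_neg_mul_sub_pow (Nat.cast_nonneg _) _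
  · simp only [neg_one_pow_mul_iteratedDeriv_neg_sub_pow]
    exact concaveOn_neg_mul_sub_pow (Nat.cast_nonneg _) _

/-- A concave function that is constant on `(a, b)` stays below that constant on `(a, c)`. -/
lemma ConcaveOn.le_of_eq_on_Ioo {a b c K : ℝ} {w : ℝ → ℝ} (hab : a < b)
    (hw : ConcaveOn ℝ (Icc a c) w) (hK : ∀ x ∈ Ioo a b, w x = K) :
    ∀ x ∈ Ioo a c, w x ≤ K := by
  intro x hx
  rcases lt_or_ge x b with hxb | hxb
  · exact (hK x ⟨hx.1, hxb⟩).le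
  obtain ⟨p, hap, hpb⟩ := exists_between hab
  obtain ⟨q, hpq, hqb⟩ := exists_between hpb
  have h := hw.slope_anti_adjacent (x := p) (y := q) (z := x)
    ⟨hap.le, by linarith [hx.2]⟩ ⟨hx.1.le, hx.2.le⟩ hpq (by linarith)
  rw [hK p ⟨hap, hpb⟩, hK q ⟨by linarith, hqb⟩, sub_self, zero_div,
    div_le_iff₀ (by linarith)] at h
  linarith

theorem stmt_19 (a b c : ℝ) (hab : a < b) (hbc : b < c)
    (m n : ℕ) (hmn : m + 1 ≤ n) (hnm : m + 4 ≤ n) :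
    (∀ i ∈ Finset.Icc (m + 1) n, UCv i a b (fun x : ℝ => -(b - x) ^ (m + 2))) ∧
    ¬ ∃ v : ℝ → ℝ, (∀ i ∈ Finset.Icc (m + 1) n, UCv i a c v) ∧
      ∀ x ∈ Set.Icc a b, v x = -(b - x) ^ (m + 2) := by
  refine ⟨fun i _ => uCv_neg_sub_pow i _ a b, ?_⟩
  rintro ⟨v, hv, hvu⟩
  obtain ⟨hdiff, -, hconc⟩ := hv (m + 4) (Finset.mem_Icc.2 ⟨by omega, hnm⟩)
  obtain ⟨-, hmono, -⟩ := hv (m + 2) (Finset.mem_Icc.2 ⟨by omega, by omega⟩)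
  replace hconc := hconc (by omega)
  simp only [show m + 4 - 2 = m + 2 by omega, show m + 2 - 2 = m by omega] at hdiff hconc hmono
  have hleft (k : ℕ) : ∀ x ∈ Ioo a b, (-1 : ℝ) ^ k * iteratedDeriv k v x
      = -(((m + 2).descFactorial k : ℝ) * (b - x) ^ (m + 2 - k)) := by
    intro x hx
    have hev : v =ᶠ[nhds x] fun x => -(b - x) ^ (m + 2) := by
      filter_upwards [Ioo_mem_nhds hx.1 hx.2] with y hy using hvu y ⟨hy.1.le, hy.2.le⟩
    rw [hev.iteratedDeriv_eq k, neg_one_pow_mul_iteratedDeriv_neg_sub_pow]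
  have hderiv (k : ℕ) (hk : k < m + 2) (x : ℝ) :
      HasDerivAt (fun x => (-1 : ℝ) ^ k * iteratedDeriv k v x)
        (-((-1 : ℝ) ^ (k + 1) * iteratedDeriv (k + 1) v x)) x := by
    have h := ((hdiff k hk x).hasDerivAt).const_mul ((-1 : ℝ) ^ k)
    rw [← iteratedDeriv_succ] at h
    exact h.congr_deriv (by ring)
  have hK : (0 : ℝ) < ((m + 2).factorial : ℝ) := by exact_mod_cast Nat.factorial_pos _
  have htop := ConcaveOn.le_of_eq_on_Ioo (K := -((m + 2).factorial : ℝ)) hab hconc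
    fun x hx => by rw [hleft (m + 2) x hx, Nat.descFactorial_self, Nat.sub_self, pow_zero, mul_one]
  obtain ⟨x, hax, hxb⟩ := exists_between hab
  obtain ⟨y, hby, hyc⟩ := exists_between hbc
  -- The signed derivative of order `m + 1` is positive to the right of `b`.
  have hpos : 0 < (-1 : ℝ) ^ (m + 1) * iteratedDeriv (m + 1) v y := by
    obtain ⟨z, hz, hslope⟩ := exists_hasDerivAt_eq_slope
      (fun x => (-1 : ℝ) ^ (m + 1) * iteratedDeriv (m + 1) v x) _ (hxb.trans hby)
      (fun t _ => (hderiv (m + 1) (by omega) t).continuousAt.continuousWithinAt)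
      (fun t _ => hderiv (m + 1) (by omega) t)
    have hz' := htop z ⟨hax.trans hz.1, hz.2.trans hyc⟩
    have hle : ((m + 2).factorial : ℝ) ≤ _ := (le_neg_of_le_neg hz').trans_eq hslope
    rw [le_div_iff₀ (by linarith), hleft (m + 1) x ⟨hax, hxb⟩] at hle
    have hfac : (m + 2).descFactorial (m + 1) = (m + 2).factorial := by
      rw [← Nat.descFactorial_self (m + 2), Nat.descFactorial_succ (m + 2) (m + 1)]
      simp
    rw [hfac, show m + 2 - (m + 1) = 1 by omega, pow_one] at hle
    nlinarith [mul_pos hK (sub_pos.2 hby)]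
  have hnonneg := hmono.derivWithin_nonneg (x := y)
  rw [(hderiv m (by omega) y).hasDerivWithinAt.derivWithin
    (uniqueDiffOn_Icc (hab.trans hbc) y ⟨by linarith, hyc.le⟩)] at hnonneg
  linarith
end
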